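/- The privacy loss of the one-dimensional Gaussian mechanism exceeds ε with probability at most δ under the calibration used by SI-DPSGD: let Δ > 0, δ ∈ (0, 1), ε ∈ (0, 1), and set σ = Δ·√(2·ln(1.25/δ))/ε. Then for all real numbers μ₁, μ₂ with |μ₁ − μ₂| ≤ Δ, if θ is distributed according to the Gaussian measure N(μ₁, σ²), the probability of the event { θ : ((θ − μ₂)² − (θ − μ₁)²)/(2σ²) > ε } is at most δ. -/

import Mathlib

open MeasureTheory ProbabilityTheory

/-- A centred Gaussian gives mass at most `1/2` to the positive half-line. -/
lemma gaussianReal_Ioi_zero_le : gaussianReal 0 1 (Set.Ioi 0) ≤ ENNReal.ofReal (1 / 2) := by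
  have hsymm : gaussianReal 0 1 (Set.Iio 0) = gaussianReal 0 1 (Set.Ioi 0) := by
    have h : (gaussianReal 0 1).map (fun x ↦ -x) = gaussianReal 0 1 := by
      simpa using gaussianReal_map_neg (μ := 0) (v := 1)
    conv_lhs => rw [← h]
    rw [Measure.map_apply measurable_neg measurableSet_Iio]
    congr 1
    ext x
    simp
  have hsum : gaussianReal 0 1 (Set.Ioi 0) + gaussianReal 0 1 (Set.Ioi 0) ≤ 1 := by
    nth_rewrite 1 [← hsymm]
    have hdisj : Disjoint (Set.Iio (0 : ℝ)) (Set.Ioi 0) :=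
      Set.disjoint_left.2 fun _ hx hx' ↦ lt_asymm (Set.mem_Iio.1 hx) (Set.mem_Ioi.1 hx')
    rw [← measure_union hdisj measurableSet_Ioi]
    exact prob_le_one
  have hreal :
      (gaussianReal 0 1 (Set.Ioi 0)).toReal + (gaussianReal 0 1 (Set.Ioi 0)).toReal ≤ 1 := by
    rw [← ENNReal.toReal_add (measure_ne_top _ _) (measure_ne_top _ _)]
    exact ENNReal.toReal_mono ENNReal.one_ne_top hsum
  rw [ENNReal.le_ofReal_iff_toReal_le (measure_ne_top _ _) (by norm_num)]
  linarith

/-- Chernoff-type tail bound for the standard Gaussian, with the sharp constant `1/2`. -/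
lemma gaussianReal_Ioi_le_half_mul_exp {t : ℝ} (ht : 0 ≤ t) :
    gaussianReal 0 1 (Set.Ioi t) ≤ ENNReal.ofReal (1 / 2 * Real.exp (-t ^ 2 / 2)) := by
  have hshift : gaussianReal 0 1 (Set.Ioi t) = ∫⁻ x in Set.Ioi 0, gaussianPDF 0 1 (x + t) := by
    rw [gaussianReal_apply _ one_ne_zero, ← lintegral_indicator measurableSet_Ioi,
      ← lintegral_indicator measurableSet_Ioi,
      ← lintegral_add_right_eq_self ((Set.Ioi t).indicator (gaussianPDF 0 1)) t]
    congr 1 with x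
    simp [Set.indicator_apply]
  calc gaussianReal 0 1 (Set.Ioi t)
    _ = ∫⁻ x in Set.Ioi 0, gaussianPDF 0 1 (x + t) := hshift
    _ ≤ ∫⁻ x in Set.Ioi 0, ENNReal.ofReal (Real.exp (-t ^ 2 / 2)) * gaussianPDF 0 1 x := by
        refine setLIntegral_mono ((measurable_gaussianPDF 0 1).const_mul _) fun x hx ↦ ?_
        rw [gaussianPDF, gaussianPDF, ← ENNReal.ofReal_mul (Real.exp_nonneg _)]
        refine ENNReal.ofReal_le_ofReal ?_
        rw [gaussianPDFReal, gaussianPDFReal, mul_left_comm, ← Real.exp_add]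
        gcongr
        have := mul_nonneg (le_of_lt hx) ht
        simp only [NNReal.coe_one]
        nlinarith
    _ = ENNReal.ofReal (Real.exp (-t ^ 2 / 2)) * gaussianReal 0 1 (Set.Ioi 0) := by
        rw [lintegral_const_mul _ (measurable_gaussianPDF 0 1), gaussianReal_apply _ one_ne_zero]
    _ ≤ ENNReal.ofReal (Real.exp (-t ^ 2 / 2)) * ENNReal.ofReal (1 / 2) := by
        gcongr
        exact gaussianReal_Ioi_zero_le
    _ = _ := by rw [← ENNReal.ofReal_mul (Real.exp_nonneg _), mul_comm]

/-- The standard Gaussian density is at most `1`. -/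
lemma gaussianPDF_zero_one_le_one (x : ℝ) : gaussianPDF 0 1 x ≤ 1 := by
  rw [gaussianPDF, ENNReal.ofReal_le_one, gaussianPDFReal]
  refine mul_le_one₀ (inv_le_one_of_one_le₀ ?_) (Real.exp_nonneg _) (Real.exp_le_one_iff.2 ?_)
  · rw [Real.one_le_sqrt]
    simp only [NNReal.coe_one]
    linarith [Real.pi_gt_three]
  · simp only [NNReal.coe_one]
    nlinarith [sq_nonneg (x - 0)]

lemma gaussianReal_Ioi_le_of_nonpos {t : ℝ} (ht : t ≤ 0) :
    gaussianReal 0 1 (Set.Ioi t) ≤ ENNReal.ofReal (1 / 2 - t) := by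
  have hIoc : gaussianReal 0 1 (Set.Ioc t 0) ≤ ENNReal.ofReal (-t) := by
    rw [gaussianReal_apply _ one_ne_zero]
    calc ∫⁻ x in Set.Ioc t 0, gaussianPDF 0 1 x
      _ ≤ ∫⁻ _ in Set.Ioc t 0, 1 := lintegral_mono gaussianPDF_zero_one_le_one
      _ = ENNReal.ofReal (-t) := by simp
  rw [← Set.Ioc_union_Ioi_eq_Ioi ht, sub_eq_neg_add,
    ENNReal.ofReal_add (neg_nonneg.2 ht) (by norm_num)]
  exact (measure_union_le _ _).trans (add_le_add hIoc gaussianReal_Ioi_zero_le)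

/-- The Gaussian tail estimate behind the calibration of the Gaussian mechanism. -/
lemma gaussianReal_Ioi_sub_inv_le {c : ℝ} (hc : 0 < c) (hc2 : 2 / 5 ≤ c ^ 2) :
    gaussianReal 0 1 (Set.Ioi (c - 1 / (2 * c))) ≤
      ENNReal.ofReal (5 / 4 * Real.exp (-c ^ 2 / 2)) := by
  rcases le_total 0 (c - 1 / (2 * c)) with ht | ht
  · refine (gaussianReal_Ioi_le_half_mul_exp ht).trans (ENNReal.ofReal_le_ofReal ?_)
    have hsq : c ^ 2 - 1 ≤ (c - 1 / (2 * c)) ^ 2 := by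
      have : (c - 1 / (2 * c)) ^ 2 = c ^ 2 - 1 + (1 / (2 * c)) ^ 2 := by
        field_simp
        ring
      rw [this]
      linarith [sq_nonneg (1 / (2 * c))]
    have hexp : Real.exp (1 / 2) ≤ 5 / 2 := by
      have h : Real.exp (1 / 2) ^ 2 = Real.exp 1 := by
        rw [← Real.exp_nat_mul]
        norm_num
      nlinarith [Real.exp_one_lt_d9, Real.exp_pos (1 / 2)]
    calc 1 / 2 * Real.exp (-(c - 1 / (2 * c)) ^ 2 / 2)
      _ ≤ 1 / 2 * Real.exp (1 / 2 + -c ^ 2 / 2) := by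
          gcongr
          linarith
      _ = 1 / 2 * Real.exp (1 / 2) * Real.exp (-c ^ 2 / 2) := by rw [Real.exp_add, mul_assoc]
      _ ≤ 5 / 4 * Real.exp (-c ^ 2 / 2) := by
          gcongr
          linarith
  · refine (gaussianReal_Ioi_le_of_nonpos ht).trans (ENNReal.ofReal_le_ofReal ?_)
    have hc2' : c ^ 2 ≤ 1 / 2 := by
      have h : c ≤ 1 / (2 * c) := by linarith
      rw [le_div_iff₀ (by positivity)] at h
      linarith
    have hc' : 3 / 5 ≤ c := by nlinarith
    have hinv : 1 / (2 * c) ≤ 5 / 6 := by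
      rw [div_le_iff₀ (by positivity)]
      linarith
    linarith [Real.add_one_le_exp (-c ^ 2 / 2)]

/-- The privacy loss exceeds `ε` with probability at most `δ` as soon as the standardized noise
exceeds the threshold `c - 1 / (2 * c)`. -/
lemma gaussianReal_privacyLoss_le {Δ ε c σ μ₁ μ₂ : ℝ} (hΔ : 0 < Δ) (hε0 : 0 < ε) (hε1 : ε < 1)
    (hc : 0 < c) (hσ : σ * ε = Δ * c) (hμ : |μ₁ - μ₂| ≤ Δ) :
    gaussianReal μ₁ (σ ^ 2).toNNReal
        {θ : ℝ | ((θ - μ₂) ^ 2 - (θ - μ₁) ^ 2) / (2 * σ ^ 2) > ε} ≤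
      gaussianReal 0 1 (Set.Ioi (c - 1 / (2 * c))) := by
  have hσ0 : 0 < σ := pos_of_mul_pos_left (hσ ▸ mul_pos hΔ hc) hε0.le
  obtain ⟨τ, hτ2, hτ⟩ : ∃ τ : ℝ, τ ^ 2 = σ ^ 2 ∧ τ * (μ₁ - μ₂) = σ * |μ₁ - μ₂| := by
    rcases abs_choice (μ₁ - μ₂) with h | h
    · exact ⟨σ, rfl, by rw [h]⟩
    · exact ⟨-σ, neg_sq σ, by rw [h]; ring⟩
  have hmap : gaussianReal μ₁ (σ ^ 2).toNNReal =
      (gaussianReal 0 1).map (fun z ↦ τ * z + μ₁) := by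
    have hcomp : (fun z ↦ τ * z + μ₁) = (· + μ₁) ∘ (τ * ·) := rfl
    rw [hcomp, ← Measure.map_map (by fun_prop) (by fun_prop), gaussianReal_map_const_mul,
      gaussianReal_map_add_const]
    congr 1
    · simp
    · ext
      simp [hτ2, sq_nonneg]
  rw [hmap, Measure.map_apply (by fun_prop) (measurableSet_lt (by fun_prop) (by fun_prop))]
  refine measure_mono fun z hz ↦ ?_
  simp only [Set.mem_preimage, Set.mem_ofPred_eq] at hz
  rw [lt_div_iff₀ (by positivity)] at hz
  set a := |μ₁ - μ₂| with ha
  have hloss : (τ * z + μ₁ - μ₂) ^ 2 - (τ * z + μ₁ - μ₁) ^ 2 = 2 * (σ * a) * z + a ^ 2 := by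
    rw [← hτ, ha, sq_abs]
    ring
  rw [hloss] at hz
  have ha0 : 0 < a := by
    refine lt_of_le_of_ne (abs_nonneg _) fun h ↦ ?_
    rw [← h] at hz
    have : 0 < ε * (2 * σ ^ 2) := by positivity
    linarith
  have hnoise : a * c ≤ σ * ε := hσ ▸ mul_le_mul_of_nonneg_right hμ hc.le
  have hac : a * c ≤ σ := hnoise.trans (mul_le_of_le_one_right hσ0.le hε1.le)
  rw [Set.mem_Ioi]
  have hinv : a ^ 2 ≤ 2 * (σ * a) * (1 / (2 * c)) := by
    have : 2 * (σ * a) * (1 / (2 * c)) = σ * a / c := by field_simp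
    rw [this, le_div_iff₀ hc]
    nlinarith
  have hmain : 2 * (σ * a) * (c - 1 / (2 * c)) < 2 * (σ * a) * z := by
    have := mul_le_mul_of_nonneg_left hnoise hσ0.le
    nlinarith
  exact lt_of_mul_lt_mul_left hmain (by positivity)

/-- The privacy loss of the one-dimensional Gaussian mechanism exceeds `ε` with probability at
most `δ` under the SI-DPSGD calibration: with sensitivity `Δ > 0`, `δ ∈ (0,1)`, `ε ∈ (0,1)` and
`σ = Δ·√(2 ln(1.25/δ))/ε`, for any means with `|μ₁ − μ₂| ≤ Δ`, the `N(μ₁, σ²)`-probability of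
`{θ | ((θ − μ₂)² − (θ − μ₁)²)/(2σ²) > ε}` is at most `δ`. -/
theorem gaussian_mechanism_privacy_loss_tail
    (Δ δ ε : ℝ) (hΔ : 0 < Δ) (hδ0 : 0 < δ) (hδ1 : δ < 1) (hε0 : 0 < ε) (hε1 : ε < 1)
    (σ : ℝ) (hσ : σ = Δ * Real.sqrt (2 * Real.log (1.25 / δ)) / ε)
    (μ₁ μ₂ : ℝ) (hμ : |μ₁ - μ₂| ≤ Δ) :
    gaussianReal μ₁ (σ ^ 2).toNNReal
        {θ : ℝ | ((θ - μ₂) ^ 2 - (θ - μ₁) ^ 2) / (2 * σ ^ 2) > ε} ≤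
      ENNReal.ofReal δ := by
  have hratio : 0 < 1.25 / δ := by positivity
  have hlog : 1 / 5 ≤ Real.log (1.25 / δ) := by
    have h := Real.one_sub_inv_le_log_of_pos hratio
    have hinv : (1.25 / δ)⁻¹ ≤ 4 / 5 := by
      rw [inv_div, div_le_iff₀ (by norm_num)]
      linarith
    linarith
  have hc : 0 < Real.sqrt (2 * Real.log (1.25 / δ)) := Real.sqrt_pos.2 (by linarith)
  have hc2 : Real.sqrt (2 * Real.log (1.25 / δ)) ^ 2 = 2 * Real.log (1.25 / δ) :=
    Real.sq_sqrt (by linarith)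
  have hδ : 5 / 4 * Real.exp (-Real.sqrt (2 * Real.log (1.25 / δ)) ^ 2 / 2) = δ := by
    rw [hc2, neg_div, mul_div_cancel_left₀ _ two_ne_zero, Real.exp_neg, Real.exp_log hratio]
    field_simp
    norm_num
  have hσε : σ * ε = Δ * Real.sqrt (2 * Real.log (1.25 / δ)) := by
    rw [hσ, div_mul_cancel₀ _ hε0.ne']
  calc _ ≤ _ := gaussianReal_privacyLoss_le hΔ hε0 hε1 hc hσε hμ
    _ ≤ _ := gaussianReal_Ioi_sub_inv_le hc (by linarith)
    _ = ENNReal.ofReal δ := by rw [hδ]
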